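/- For every complete lattice (𝓛, ≤), the category GraphLattice(𝓛,≤) has all pushouts. Concretely, the pushout of a span φ : C → A, ψ : C → B is computed as in the category of unlabeled graphs on underlying vertex and edge sets (the quotient of the disjoint union V_A ⊎ V_B by the equivalence relation generated by φ_V(c) ∼ ψ_V(c) for c ∈ V_C, and similarly for edges), where each equivalence class carries as label the join (supremum) in 𝓛 of the labels of all its members. -/

import Mathlib

open CategoryTheory CategoryTheory.Limits

universe w

/-- A graph labeled from a complete lattice `𝓛`: vertices `V`, edges `E`,
source and target maps, and vertex/edge labeling functions into `𝓛`. -/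
structure LGraph (𝓛 : Type w) [CompleteLattice 𝓛] where
  V : Type
  E : Type
  src : E → V
  tgt : E → V
  lV : V → 𝓛
  lE : E → 𝓛

/-- A morphism of `𝓛`-labeled graphs: a graph premorphism that may only
increase labels. -/
@[ext]
structure LGraphHom {𝓛 : Type w} [CompleteLattice 𝓛] (G G' : LGraph 𝓛) where
  fV : G.V → G'.V
  fE : G.E → G'.E
  src_comm : ∀ e, G'.src (fE e) = fV (G.src e)
  tgt_comm : ∀ e, G'.tgt (fE e) = fV (G.tgt e)
  lV_le : ∀ v, G.lV v ≤ G'.lV (fV v)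
  lE_le : ∀ e, G.lE e ≤ G'.lE (fE e)

/-- The category `GraphLattice(𝓛,≤)` of `𝓛`-labeled graphs. -/
instance LGraph.category {𝓛 : Type w} [CompleteLattice 𝓛] :
    Category (LGraph 𝓛) where
  Hom := LGraphHom
  id G :=
    { fV := id, fE := id
      src_comm := fun _ => rfl, tgt_comm := fun _ => rfl
      lV_le := fun _ => le_rfl, lE_le := fun _ => le_rfl }
  comp f g :=
    { fV := fun v => g.fV (f.fV v), fE := fun e => g.fE (f.fE e)
      src_comm := fun e => by rw [g.src_comm, f.src_comm]
      tgt_comm := fun e => by rw [g.tgt_comm, f.tgt_comm]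
      lV_le := fun v => (f.lV_le v).trans (g.lV_le _)
      lE_le := fun e => (f.lE_le e).trans (g.lE_le _) }

variable {𝓛 : Type w} [CompleteLattice 𝓛]

/-- The relation on vertices of the disjoint union generating the pushout
identification: `inl (φ c) ∼ inr (ψ c)` for every vertex `c` of `C`. -/
def LGraph.poRelV {A B C : LGraph 𝓛} (φ : C ⟶ A) (ψ : C ⟶ B) :
    A.V ⊕ B.V → A.V ⊕ B.V → Prop :=
  fun x y => ∃ c : C.V, x = Sum.inl (φ.fV c) ∧ y = Sum.inr (ψ.fV c)

/-- The relation on edges of the disjoint union generating the pushout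
identification: `inl (φ c) ∼ inr (ψ c)` for every edge `c` of `C`. -/
def LGraph.poRelE {A B C : LGraph 𝓛} (φ : C ⟶ A) (ψ : C ⟶ B) :
    A.E ⊕ B.E → A.E ⊕ B.E → Prop :=
  fun x y => ∃ c : C.E, x = Sum.inl (φ.fE c) ∧ y = Sum.inr (ψ.fE c)

/-- The concrete pushout graph of a span `φ : C ⟶ A`, `ψ : C ⟶ B` in
`GraphLattice(𝓛,≤)`: the usual pushout of unlabeled graphs (the quotient of
the disjoint union by the equivalence relation generated by
`φ(c) ∼ ψ(c)`), where each equivalence class carries the join of the labels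
of all its members. -/
def LGraph.poGraph {A B C : LGraph 𝓛} (φ : C ⟶ A) (ψ : C ⟶ B) : LGraph 𝓛 where
  V := Quot (LGraph.poRelV φ ψ)
  E := Quot (LGraph.poRelE φ ψ)
  src := Quot.lift (fun e => Quot.mk _ (Sum.map A.src B.src e)) (by
    rintro _ _ ⟨c, rfl, rfl⟩
    simp only [Sum.map_inl, Sum.map_inr, φ.src_comm, ψ.src_comm]
    exact Quot.sound ⟨C.src c, rfl, rfl⟩)
  tgt := Quot.lift (fun e => Quot.mk _ (Sum.map A.tgt B.tgt e)) (by
    rintro _ _ ⟨c, rfl, rfl⟩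
    simp only [Sum.map_inl, Sum.map_inr, φ.tgt_comm, ψ.tgt_comm]
    exact Quot.sound ⟨C.tgt c, rfl, rfl⟩)
  lV q := sSup (Sum.elim A.lV B.lV '' { v | Quot.mk (LGraph.poRelV φ ψ) v = q })
  lE q := sSup (Sum.elim A.lE B.lE '' { e | Quot.mk (LGraph.poRelE φ ψ) e = q })

/-- The left inclusion into the concrete pushout graph. -/
def LGraph.poInl {A B C : LGraph 𝓛} (φ : C ⟶ A) (ψ : C ⟶ B) :
    A ⟶ LGraph.poGraph φ ψ where
  fV v := Quot.mk _ (Sum.inl v)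
  fE e := Quot.mk _ (Sum.inl e)
  src_comm _ := rfl
  tgt_comm _ := rfl
  lV_le v := le_sSup ⟨Sum.inl v, rfl, rfl⟩
  lE_le e := le_sSup ⟨Sum.inl e, rfl, rfl⟩

/-- The right inclusion into the concrete pushout graph. -/
def LGraph.poInr {A B C : LGraph 𝓛} (φ : C ⟶ A) (ψ : C ⟶ B) :
    B ⟶ LGraph.poGraph φ ψ where
  fV v := Quot.mk _ (Sum.inr v)
  fE e := Quot.mk _ (Sum.inr e)
  src_comm _ := rfl
  tgt_comm _ := rfl
  lV_le v := le_sSup ⟨Sum.inr v, rfl, rfl⟩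
  lE_le e := le_sSup ⟨Sum.inr e, rfl, rfl⟩

/-- Two morphisms of labeled graphs agree as soon as they agree on vertices and on edges. -/
theorem LGraph.hom_ext {G H : LGraph 𝓛} {f g : G ⟶ H}
    (hV : ∀ v, f.fV v = g.fV v) (hE : ∀ e, f.fE e = g.fE e) : f = g :=
  LGraphHom.ext (funext hV) (funext hE)

theorem LGraph.poGraph_condition {A B C : LGraph 𝓛} (φ : C ⟶ A) (ψ : C ⟶ B) :
    φ ≫ LGraph.poInl φ ψ = ψ ≫ LGraph.poInr φ ψ :=
  LGraph.hom_ext (fun c => Quot.sound ⟨c, rfl, rfl⟩) (fun c => Quot.sound ⟨c, rfl, rfl⟩)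

/-- The morphism out of the concrete pushout graph induced by a commutative square. -/
def LGraph.poDesc {A B C X : LGraph 𝓛} {φ : C ⟶ A} {ψ : C ⟶ B} (f : A ⟶ X) (g : B ⟶ X)
    (h : φ ≫ f = ψ ≫ g) : LGraph.poGraph φ ψ ⟶ X where
  fV := Quot.lift (Sum.elim f.fV g.fV) (by
    rintro _ _ ⟨c, rfl, rfl⟩
    exact congrFun (congrArg LGraphHom.fV h) c)
  fE := Quot.lift (Sum.elim f.fE g.fE) (by
    rintro _ _ ⟨c, rfl, rfl⟩
    exact congrFun (congrArg LGraphHom.fE h) c)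
  src_comm := by
    rintro ⟨e | e⟩
    · exact f.src_comm e
    · exact g.src_comm e
  tgt_comm := by
    rintro ⟨e | e⟩
    · exact f.tgt_comm e
    · exact g.tgt_comm e
  lV_le q := by
    refine sSup_le ?_
    rintro _ ⟨v | v, rfl, rfl⟩
    · exact f.lV_le v
    · exact g.lV_le v
  lE_le q := by
    refine sSup_le ?_
    rintro _ ⟨e | e, rfl, rfl⟩
    · exact f.lE_le e
    · exact g.lE_le e

theorem LGraph.poGraph_hom_ext {A B C X : LGraph 𝓛} {φ : C ⟶ A} {ψ : C ⟶ B}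
    {f g : LGraph.poGraph φ ψ ⟶ X}
    (hl : LGraph.poInl φ ψ ≫ f = LGraph.poInl φ ψ ≫ g)
    (hr : LGraph.poInr φ ψ ≫ f = LGraph.poInr φ ψ ≫ g) : f = g := by
  refine LGraph.hom_ext ?_ ?_
  · rintro ⟨v | v⟩
    · exact congrFun (congrArg LGraphHom.fV hl) v
    · exact congrFun (congrArg LGraphHom.fV hr) v
  · rintro ⟨e | e⟩
    · exact congrFun (congrArg LGraphHom.fE hl) e
    · exact congrFun (congrArg LGraphHom.fE hr) e

theorem LGraph.isPushout_poGraph {A B C : LGraph 𝓛} (φ : C ⟶ A) (ψ : C ⟶ B) :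
    IsPushout φ ψ (LGraph.poInl φ ψ) (LGraph.poInr φ ψ) :=
  ⟨⟨LGraph.poGraph_condition φ ψ⟩, ⟨PushoutCocone.IsColimit.mk _
    (fun s => LGraph.poDesc s.inl s.inr s.condition)
    (fun _ => rfl) (fun _ => rfl)
    (fun _ _ hl hr => LGraph.poGraph_hom_ext hl hr)⟩⟩

/-- **`GraphLattice(𝓛,≤)` has all pushouts**, and the pushout of a span
`φ : C ⟶ A`, `ψ : C ⟶ B` is computed as for unlabeled graphs (a quotient of
the disjoint union), with each equivalence class labeled by the join of the
labels of all its members. -/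
theorem lGraph_hasPushouts (𝓛 : Type w) [CompleteLattice 𝓛] :
    HasPushouts (LGraph 𝓛) ∧
    ∀ {A B C : LGraph 𝓛} (φ : C ⟶ A) (ψ : C ⟶ B),
      IsPushout φ ψ (LGraph.poInl φ ψ) (LGraph.poInr φ ψ) := by
  have (A B C : LGraph 𝓛) (φ : C ⟶ A) (ψ : C ⟶ B) : HasPushout φ ψ :=
    (LGraph.isPushout_poGraph φ ψ).hasPushout
  exact ⟨hasPushouts_of_hasColimit_span _, LGraph.isPushout_poGraph⟩
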